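/- Let λ = (λ_1,…,λ_c) and μ = (μ_1,…,μ_c) be elements of k^c. Then in A the identity ∑_{i=1}^c μ_i λ_i q^{i−1} · u_λ^{a−1} · (x_1^{a−1} ⋯ x_{i−1}^{a−1} x_{i+1}^{a−1} ⋯ x_c^{a−1}) = (∑_{i=1}^c μ_i λ_i^a) · x_1^{a−1} x_2^{a−1} ⋯ x_c^{a−1} holds, where the products of the x_n^{a−1} are taken in increasing order of the index n. -/

import Mathlib

open scoped TensorProduct

/-- The relations defining the quantum complete intersection `A^c_q`:
`x_i ^ a = 0` for all `i`, and `x_i x_j = q • x_j x_i` for `i < j`. -/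
inductive QCIRel (k : Type) [Field k] (c a : ℕ) (q : k) :
    FreeAlgebra k (Fin c) → FreeAlgebra k (Fin c) → Prop
  | pow (i : Fin c) : QCIRel k c a q (FreeAlgebra.ι k i ^ a) 0
  | comm (i j : Fin c) (hij : i < j) :
      QCIRel k c a q (FreeAlgebra.ι k i * FreeAlgebra.ι k j)
        (q • (FreeAlgebra.ι k j * FreeAlgebra.ι k i))

/-- The quantum complete intersection algebra `A^c_q = k⟨x_1,…,x_c⟩/(x_i^a, x_ix_j - q x_jx_i)`. -/
def QCI (k : Type) [Field k] (c a : ℕ) (q : k) : Type := RingQuot (QCIRel k c a q)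

noncomputable instance (k : Type) [Field k] (c a : ℕ) (q : k) : Ring (QCI k c a q) :=
  inferInstanceAs (Ring (RingQuot (QCIRel k c a q)))

noncomputable instance (k : Type) [Field k] (c a : ℕ) (q : k) : Algebra k (QCI k c a q) :=
  inferInstanceAs (Algebra k (RingQuot (QCIRel k c a q)))

namespace QCI

variable (k : Type) [Field k] (c a : ℕ) (q : k)

/-- The generators `x_i` of the quantum complete intersection. -/
noncomputable def x (i : Fin c) : QCI k c a q :=
  RingQuot.mkAlgHom k (QCIRel k c a q) (FreeAlgebra.ι k i)

/-- The element `u_λ = λ_1 x_1 + ⋯ + λ_c x_c` of `A^c_q`. -/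
noncomputable def u (lam : Fin c → k) : QCI k c a q :=
  ∑ i, lam i • QCI.x k c a q i

end QCI

/-- `a' = a / gcd(a, char k)` if `char k > 0`, and `a' = a` if `char k = 0`. -/
noncomputable def aprime (k : Type) [Field k] (a : ℕ) : ℕ :=
  if ringChar k > 0 then a / Nat.gcd a (ringChar k) else a

section QCommuting

variable {k A : Type*} [Field k] [Ring A] [Algebra k A]

theorem mul_pow_of_qcomm {s : k} {x y : A} (h : x * y = s • (y * x)) (n : ℕ) :
    x * y ^ n = s ^ n • (y ^ n * x) := by
  induction n with
  | zero => simp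
  | succ n ih =>
    rw [pow_succ, ← mul_assoc, ih, smul_mul_assoc, mul_assoc, h, mul_smul_comm, smul_smul,
      pow_succ, mul_assoc]

theorem pow_mul_of_qcomm {s : k} {x y : A} (h : x * y = s • (y * x)) (m : ℕ) :
    x ^ m * y = s ^ m • (y * x ^ m) := by
  induction m with
  | zero => simp
  | succ m ih =>
    rw [pow_succ', mul_assoc, ih, mul_smul_comm, ← mul_assoc, h, smul_mul_assoc, smul_smul,
      pow_succ, mul_assoc]

theorem pow_mul_pow_of_qcomm {s : k} {x y : A} (h : x * y = s • (y * x)) (m n : ℕ) :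
    x ^ m * y ^ n = s ^ (n * m) • (y ^ n * x ^ m) := by
  rw [pow_mul_of_qcomm (mul_pow_of_qcomm h n) m, pow_mul]

/-- If `x` commutes up to scalars with every entry of a list and annihilates one of them,
then it annihilates the product. -/
theorem mul_list_prod_eq_zero_of_qcomm {x : A} {l : List A}
    (hl : ∀ y ∈ l, ∃ s : k, x * y = s • (y * x)) (hz : ∃ z ∈ l, x * z = 0) :
    x * l.prod = 0 := by
  induction l with
  | nil => simp at hz
  | cons y l ih =>
    rw [List.prod_cons, ← mul_assoc]
    obtain ⟨z, hzl, hz⟩ := hz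
    rcases List.mem_cons.1 hzl with rfl | hzl
    · rw [hz, zero_mul]
    · obtain ⟨s, hs⟩ := hl y (by simp)
      rw [hs, smul_mul_assoc, mul_assoc,
        ih (fun y' hy' => hl y' (List.mem_cons_of_mem _ hy')) ⟨z, hzl, hz⟩, mul_zero, smul_zero]

/-- Moving the factor `f i` of an ordered product to the front costs a power of `q`. -/
theorem pow_smul_mul_ofFn_prod (q : k) {c : ℕ} (f : Fin c → A) (i : Fin c)
    (h : ∀ j < i, f j * f i = q • (f i * f j)) :
    q ^ (i : ℕ) • (f i * (List.ofFn fun n => if n = i then 1 else f n).prod) =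
      (List.ofFn f).prod := by
  induction c with
  | zero => exact i.elim0
  | succ c ih =>
    rw [List.ofFn_succ, List.ofFn_succ, List.prod_cons, List.prod_cons]
    induction i using Fin.cases with
    | zero => simp [Fin.succ_ne_zero]
    | succ i =>
      have ih' := ih (fun n => f n.succ) i fun j hj => h _ (Fin.succ_lt_succ_iff.2 hj)
      simp only [Fin.succ_inj, (Fin.succ_ne_zero i).symm, if_false, Fin.val_succ]
      rw [← ih', ← mul_assoc, pow_succ, ← smul_smul, ← smul_mul_assoc q,
        ← h 0 (Fin.succ_pos i), mul_smul_comm, mul_assoc]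

end QCommuting

namespace QCI

variable {k : Type} [Field k] {c a : ℕ} {q : k}

theorem x_pow (i : Fin c) : x k c a q i ^ a = 0 := by
  have h := RingQuot.mkAlgHom_rel k (QCIRel.pow (k := k) (a := a) (q := q) i)
  rw [map_pow, map_zero] at h
  exact h

theorem x_mul_x {i j : Fin c} (hij : i < j) :
    x k c a q i * x k c a q j = q • (x k c a q j * x k c a q i) := by
  have h := RingQuot.mkAlgHom_rel k (QCIRel.comm (k := k) (a := a) (q := q) i j hij)
  rw [map_mul, map_smul, map_mul] at h
  exact h

theorem exists_x_mul_x (hq : q ≠ 0) (i j : Fin c) :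
    ∃ s : k, x k c a q i * x k c a q j = s • (x k c a q j * x k c a q i) := by
  rcases lt_trichotomy i j with h | rfl | h
  · exact ⟨q, x_mul_x h⟩
  · exact ⟨1, (one_smul _ _).symm⟩
  · exact ⟨q⁻¹, by rw [x_mul_x h, inv_smul_smul₀ hq]⟩

/-- The ordered product of the `x_n ^ (a - 1)` over `n ≠ i` is annihilated by each `x_n`, `n ≠ i`. -/
theorem x_mul_prod_eq_zero (ha : 1 ≤ a) (hq : q ≠ 0) {i n : Fin c} (hn : n ≠ i) :
    x k c a q n *
      (List.ofFn fun m : Fin c => if m = i then 1 else x k c a q m ^ (a - 1)).prod = 0 := by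
  refine mul_list_prod_eq_zero_of_qcomm (k := k) (fun y hy => ?_) ⟨x k c a q n ^ (a - 1), ?_, ?_⟩
  · obtain ⟨m, rfl⟩ := List.mem_ofFn.1 hy
    split_ifs
    · exact ⟨1, by simp⟩
    · obtain ⟨s, hs⟩ := exists_x_mul_x (a := a) hq n m
      exact ⟨_, mul_pow_of_qcomm hs _⟩
  · exact List.mem_ofFn.2 ⟨n, if_neg hn⟩
  · rw [← pow_succ', Nat.sub_add_cancel ha, x_pow]

theorem u_pow_mul_prod (ha : 1 ≤ a) (hq : q ≠ 0) (lam : Fin c → k) (i : Fin c) (m : ℕ) :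
    u k c a q lam ^ m *
        (List.ofFn fun n : Fin c => if n = i then 1 else x k c a q n ^ (a - 1)).prod =
      lam i ^ m • (x k c a q i ^ m *
        (List.ofFn fun n : Fin c => if n = i then 1 else x k c a q n ^ (a - 1)).prod) := by
  induction m with
  | zero => simp
  | succ m ih =>
    rw [pow_succ', mul_assoc, ih, mul_smul_comm, u, Finset.sum_mul,
      Finset.sum_eq_single_of_mem i (Finset.mem_univ i), smul_mul_assoc, smul_smul, ← pow_succ,
      ← mul_assoc, ← pow_succ']
    intro n _ hn
    obtain ⟨s, hs⟩ := exists_x_mul_x (a := a) hq n i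
    rw [smul_mul_assoc, ← mul_assoc, mul_pow_of_qcomm hs, smul_mul_assoc, mul_assoc,
      x_mul_prod_eq_zero ha hq hn, mul_zero, smul_zero, smul_zero]

end QCI

theorem aprime_dvd (k : Type) [Field k] (a : ℕ) : aprime k a ∣ a := by
  unfold aprime
  split_ifs
  · exact Nat.div_dvd_of_dvd (Nat.gcd_dvd_left _ _)
  · exact dvd_rfl

/-- For `λ, μ ∈ k^c`, the identity
`∑_i μ_i λ_i q^{i-1} · u_λ^{a-1} · (x_1^{a-1} ⋯ x_{i-1}^{a-1} x_{i+1}^{a-1} ⋯ x_c^{a-1})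
  = (∑_i μ_i λ_i^a) · x_1^{a-1} ⋯ x_c^{a-1}`
holds in `A = A^c_q`, the products being taken in increasing order of the index. -/
theorem uLam_pow_mul_monomial (k : Type) [Field k] [IsAlgClosed k] (a c : ℕ) (ha : 2 ≤ a)
    (hc : 1 ≤ c) (q : k) (hq : IsPrimitiveRoot q (aprime k a)) (lam mu : Fin c → k) :
    ∑ i : Fin c, (mu i * lam i * q ^ (i : ℕ)) •
        (QCI.u k c a q lam ^ (a - 1) *
          (List.ofFn fun n : Fin c =>
            if n = i then 1 else QCI.x k c a q n ^ (a - 1)).prod)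
      = (∑ i : Fin c, mu i * lam i ^ a) •
          (List.ofFn fun n : Fin c => QCI.x k c a q n ^ (a - 1)).prod := by
  have hqa : q ^ a = 1 := (hq.pow_eq_one_iff_dvd a).2 (aprime_dvd k a)
  have hq0 : q ≠ 0 := by
    rintro rfl
    rw [zero_pow (by omega)] at hqa
    exact zero_ne_one hqa
  have hsq : q ^ ((a - 1) * (a - 1)) = q := by
    obtain ⟨b, rfl⟩ := Nat.exists_eq_add_of_le ha
    rw [show (2 + b - 1) * (2 + b - 1) = (2 + b) * b + 1 by
      rw [show 2 + b - 1 = b + 1 by omega]; ring, pow_succ, pow_mul, hqa, one_pow, one_mul]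
  rw [Finset.sum_smul]
  refine Finset.sum_congr rfl fun i _ => ?_
  rw [QCI.u_pow_mul_prod (by omega) hq0,
    ← pow_smul_mul_ofFn_prod q (fun n => QCI.x k c a q n ^ (a - 1)) i fun j hj => by
      rw [pow_mul_pow_of_qcomm (QCI.x_mul_x hj), hsq],
    smul_smul, smul_smul]
  congr 1
  obtain ⟨b, rfl⟩ := Nat.exists_eq_add_of_le ha
  rw [show 2 + b - 1 = b + 1 by omega]
  ring
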